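/- Let h: ℝ → ℝ be bounded and let g_h be the bounded solution of the Stein equation g'(w) − w g(w) = h(w) − Nh, where Nh = E h(Z) for Z ~ N(0,1). Then ‖g_h‖_∞ ≤ √(π/2) ‖h − Nh‖_∞ and ‖g_h'‖_∞ ≤ 2 ‖h − Nh‖_∞. If moreover h is absolutely continuous with bounded derivative, then ‖g_h‖_∞ ≤ 2‖h'‖_∞, ‖g_h'‖_∞ ≤ √(2/π) ‖h'‖_∞, and ‖g_h''‖_∞ ≤ 2‖h'‖_∞. -/

import Mathlib

open MeasureTheory ProbabilityTheory

noncomputable def steinNh (h : ℝ → ℝ) : ℝ := ∫ x, h x ∂(gaussianReal 0 1)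

noncomputable def steinSol (h : ℝ → ℝ) (w : ℝ) : ℝ :=
  Real.exp (w ^ 2 / 2) * ∫ x in Set.Iic w, (h x - steinNh h) * Real.exp (-x ^ 2 / 2)


open Set Filter Topology

noncomputable def sphi (x : ℝ) : ℝ := Real.exp (-x ^ 2 / 2)
noncomputable def sP (w : ℝ) : ℝ := ∫ x in Set.Iic w, sphi x
noncomputable def sU (w : ℝ) : ℝ := ∫ x in Set.Ioi w, sphi x
noncomputable def sc : ℝ := Real.sqrt (Real.pi / 2)
noncomputable def sE (w : ℝ) : ℝ := sP w - sc

lemma sphi_pos (x : ℝ) : 0 < sphi x := Real.exp_pos _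
lemma sphi_zero : sphi 0 = 1 := by simp [sphi]
lemma sphi_neg (x : ℝ) : sphi (-x) = sphi x := by simp [sphi]
lemma sphi_hasDeriv (x : ℝ) : HasDerivAt sphi (-x * sphi x) x := by
  have h1 : HasDerivAt (fun x : ℝ => -x ^ 2 / 2) (-x) x := by
    have := ((hasDerivAt_pow 2 x).neg).div_const 2
    refine this.congr_deriv ?_
    push_cast; ring
  have := h1.exp
  unfold sphi
  convert this using 1
  ring
lemma sphi_cont : Continuous sphi := by unfold sphi; fun_prop
lemma sphi_eq : sphi = fun x => Real.exp (-(1/2 : ℝ) * x ^ 2) := by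
  funext x; unfold sphi; congr 1; ring
lemma sphi_int : Integrable sphi := by
  rw [sphi_eq]; exact integrable_exp_neg_mul_sq (by norm_num)
lemma xsphi_int : Integrable (fun x => x * sphi x) := by
  rw [sphi_eq]; exact integrable_mul_exp_neg_mul_sq (by norm_num)
lemma sc_pos : 0 < sc := by unfold sc; positivity
lemma sc_sq : sc ^ 2 = Real.pi / 2 := by unfold sc; rw [Real.sq_sqrt]; positivity
lemma two_sc : 2 * sc = Real.sqrt (2 * Real.pi) := by
  symm
  rw [Real.sqrt_eq_iff_mul_self_eq (by positivity) (by have := sc_pos; positivity)]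
  have := sc_sq
  nlinarith
lemma sphi_total : ∫ x, sphi x = 2 * sc := by
  rw [sphi_eq, integral_gaussian, two_sc]
  congr 1; ring
lemma split_int {f : ℝ → ℝ} (hf : Integrable f) (w : ℝ) :
    (∫ x in Iic w, f x) + ∫ x in Ioi w, f x = ∫ x, f x := by
  rw [← compl_Iic]
  exact integral_add_compl measurableSet_Iic hf
lemma sPU (w : ℝ) : sP w + sU w = 2 * sc := by
  rw [← sphi_total]; exact split_int sphi_int w
lemma sP_neg (w : ℝ) : sP (-w) = sU w := by
  have := integral_comp_neg_Iic (-w) sphi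
  simp only [sphi_neg, neg_neg] at this
  exact this
lemma sP_zero : sP 0 = sc := by
  have h1 := sP_neg 0
  have h2 := sPU 0
  simp at h1
  linarith
lemma sE_zero : sE 0 = 0 := by simp [sE, sP_zero]
lemma sP_eq (w : ℝ) : sP w = sc + sE w := by unfold sE; ring
lemma sU_eq (w : ℝ) : sU w = sc - sE w := by have := sPU w; unfold sE; linarith
lemma sE_neg (w : ℝ) : sE (-w) = - sE w := by
  have := sP_neg w
  rw [sP_eq, sU_eq] at this; linarith
lemma sP_nonneg (w : ℝ) : 0 ≤ sP w := setIntegral_nonneg measurableSet_Iic fun x _ => (sphi_pos x).le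
lemma sU_nonneg (w : ℝ) : 0 ≤ sU w := setIntegral_nonneg measurableSet_Ioi fun x _ => (sphi_pos x).le

lemma hasDeriv_Iic {f : ℝ → ℝ} (hf : Integrable f) (w : ℝ) (hc : ContinuousAt f w) :
    HasDerivAt (fun w => ∫ x in Iic w, f x) (f w) w := by
  have h1 : (fun w => ∫ x in Iic w, f x) = fun w => (∫ x in Iic (0:ℝ), f x) + ∫ x in (0:ℝ)..w, f x := by
    funext w
    rw [← intervalIntegral.integral_Iic_sub_Iic hf.integrableOn hf.integrableOn]; ring
  rw [h1]
  refine HasDerivAt.const_add _ ?_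
  exact intervalIntegral.integral_hasDerivAt_right hf.intervalIntegrable
    (hf.aestronglyMeasurable.stronglyMeasurableAtFilter) hc

lemma sE_hasDeriv (w : ℝ) : HasDerivAt sE (sphi w) w := by
  unfold sE
  exact (hasDeriv_Iic sphi_int w sphi_cont.continuousAt).sub_const _

lemma sE_nonneg {w : ℝ} (hw : 0 ≤ w) : 0 ≤ sE w := by
  have : MonotoneOn sE (Ici 0) := by
    refine (monotone_of_hasDerivAt_nonneg sE_hasDeriv fun x => (sphi_pos x).le).monotoneOn _
  have := this (by simp) (by simpa using hw) hw
  rwa [sE_zero] at this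
lemma sE_le (w : ℝ) : sE w ≤ sc := by have := sU_nonneg w; rw [sU_eq] at this; linarith

lemma sphi_tendsto : Tendsto sphi atTop (𝓝 0) := by
  unfold sphi
  apply Real.tendsto_exp_atBot.comp
  apply Tendsto.atBot_div_const (by norm_num)
  exact tendsto_neg_atTop_atBot.comp (tendsto_pow_atTop (by norm_num))
lemma wsphi_le {x : ℝ} (hx : 1 ≤ x) : x * sphi x ≤ 2 / x := by
  have h : 1 + x^2/2 ≤ Real.exp (x^2/2) := by linarith [Real.add_one_le_exp (x^2/2)]
  have h2 : sphi x * Real.exp (x^2/2) = 1 := by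
    unfold sphi; rw [← Real.exp_add]; simp; ring
  have := sphi_pos x
  rw [le_div_iff₀ (by linarith)]
  nlinarith
lemma wsphi_tendsto : Tendsto (fun x => x * sphi x) atTop (𝓝 0) := by
  have h : Tendsto (fun x : ℝ => 2 / x) atTop (𝓝 0) := tendsto_const_nhds.div_atTop tendsto_id
  refine squeeze_zero' ?_ ?_ h
  · filter_upwards [eventually_ge_atTop 1] with x hx
    have := sphi_pos x; positivity
  · filter_upwards [eventually_ge_atTop 1] with x hx using wsphi_le hx

lemma xsphi_Ioi (w : ℝ) : ∫ x in Ioi w, x * sphi x = sphi w := by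
  have := integral_Ioi_of_hasDerivAt_of_tendsto' (a := w) (f := fun x => - sphi x) (f' := fun x => x * sphi x) (m := 0)
    (fun x _ => (sphi_hasDeriv x).neg.congr_deriv (by ring)) xsphi_int.integrableOn
    (by simpa using sphi_tendsto.neg)
  rw [this]; ring
lemma xsphi_total : ∫ x, x * sphi x = 0 := by
  have h1 := integral_neg_eq_self (fun x => x * sphi x) volume
  simp only [sphi_neg, neg_mul, integral_neg] at h1
  linarith
lemma xsphi_Iic (w : ℝ) : ∫ x in Iic w, x * sphi x = - sphi w := by
  have := split_int xsphi_int w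
  rw [xsphi_Ioi, xsphi_total] at this; linarith

lemma M1 (w : ℝ) : w * sU w ≤ sphi w := by
  rw [← xsphi_Ioi, sU, ← integral_const_mul]
  refine setIntegral_mono_on (sphi_int.const_mul w).integrableOn xsphi_int.integrableOn measurableSet_Ioi ?_
  intro x hx
  exact mul_le_mul_of_nonneg_right (le_of_lt hx) (sphi_pos x).le
lemma M1' (w : ℝ) : -w * sP w ≤ sphi w := by
  have := M1 (-w)
  rwa [← sP_neg, neg_neg, sphi_neg] at this
lemma sU_hasDeriv (w : ℝ) : HasDerivAt sU (-sphi w) w := by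
  have : sU = fun w => sc - sE w := by funext w; exact sU_eq w
  rw [this]
  exact (sE_hasDeriv w).const_sub _
lemma sU_tendsto : Tendsto sU atTop (𝓝 0) := by
  refine squeeze_zero' (Eventually.of_forall sU_nonneg) ?_ sphi_tendsto
  filter_upwards [eventually_ge_atTop 1] with x hx
  have := M1 x; have := sU_nonneg x; nlinarith
lemma sE_tendsto : Tendsto sE atTop (𝓝 sc) := by
  have : sE = fun w => sc - sU w := by funext w; rw [sU_eq]; ring
  rw [this]
  simpa using sU_tendsto.const_sub sc
lemma M2 (w : ℝ) : w * sphi w ≤ (1 + w^2) * sU w := by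
  have hd : ∀ x, HasDerivAt (fun x => sU x - x * sphi x / (1 + x^2)) (-(2 * sphi x / (1+x^2)^2)) x := by
    intro x
    have h0 : (1 + x^2) ≠ 0 := by positivity
    have := (sU_hasDeriv x).sub ((((hasDerivAt_id x).mul (sphi_hasDeriv x))).div ((hasDerivAt_pow 2 x).const_add 1) h0)
    refine this.congr_deriv ?_
    simp
    field_simp
    ring
  have ha : Antitone (fun x => sU x - x * sphi x / (1 + x^2)) :=
    antitone_of_hasDerivAt_nonpos hd fun x => by
      have := sphi_pos x
      simp only [Pi.zero_apply, Left.neg_nonpos_iff]; positivity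
  have hl : Tendsto (fun x => sU x - x * sphi x / (1 + x^2)) atTop (𝓝 0) := by
    have : Tendsto (fun x => x * sphi x / (1 + x^2)) atTop (𝓝 0) := by
      refine squeeze_zero' ?_ ?_ wsphi_tendsto
      · filter_upwards [eventually_ge_atTop 1] with x hx
        have := sphi_pos x; positivity
      · filter_upwards [eventually_ge_atTop 1] with x hx
        have := sphi_pos x
        apply div_le_self (by positivity); nlinarith
    simpa using sU_tendsto.sub this
  have := ha.le_of_tendsto hl w
  have h3 : w * sphi w / (1 + w^2) ≤ sU w := by linarith
  rw [div_le_iff₀ (by positivity)] at h3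
  linarith
lemma M2' (w : ℝ) : -w * sphi w ≤ (1 + w^2) * sP w := by
  have := M2 (-w)
  rw [← sP_neg, neg_neg, sphi_neg] at this
  simpa using this
noncomputable def sexp (w : ℝ) : ℝ := Real.exp (w^2/2)
lemma sexp_pos (w : ℝ) : 0 < sexp w := Real.exp_pos _
lemma sexp_mul (w : ℝ) : sexp w * sphi w = 1 := by
  unfold sexp sphi; rw [← Real.exp_add]; simp; ring
lemma sexp_hasDeriv (w : ℝ) : HasDerivAt sexp (w * sexp w) w := by
  have h1 : HasDerivAt (fun x : ℝ => x ^ 2 / 2) w w := by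
    have := (hasDerivAt_pow 2 w).div_const 2
    refine this.congr_deriv ?_
    push_cast; ring
  have := h1.exp
  unfold sexp
  convert this using 1
  ring
lemma M3 {w : ℝ} (hw : 0 ≤ w) : sexp w * sU w ≤ sc := by
  have ha : Antitone (fun x => sexp x * sU x) := by
    refine antitone_of_hasDerivAt_nonpos (fun x => (sexp_hasDeriv x).mul (sU_hasDeriv x)) fun x => ?_
    have := M1 x
    have := sexp_pos x
    simp only [Pi.zero_apply]; nlinarith
  have := ha hw
  simp only at this
  rw [sU_eq 0, sE_zero] at this
  simpa [sexp] using this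
lemma M3' {w : ℝ} (hw : w ≤ 0) : sexp w * sP w ≤ sc := by
  have := M3 (w := -w) (by linarith)
  rw [← sP_neg, neg_neg] at this
  simpa [sexp] using this

/-- Once nonnegative, stays nonnegative (on the positive axis). -/
def SC (k : ℝ → ℝ) : Prop := ∀ x y : ℝ, 0 < x → x ≤ y → 0 ≤ k x → 0 ≤ k y

lemma mono_from {f f' : ℝ → ℝ} (hd : ∀ x, 0 < x → HasDerivAt f (f' x) x) {a : ℝ} (ha : 0 < a)
    (hk : ∀ x, a ≤ x → 0 ≤ f' x) : MonotoneOn f (Ici a) := by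
  refine monotoneOn_of_hasDerivWithinAt_nonneg (f' := f') (convex_Ici a) ?_ ?_ ?_
  · intro x hx; exact (hd x (lt_of_lt_of_le ha hx)).continuousAt.continuousWithinAt
  · intro x hx; rw [interior_Ici] at hx; exact (hd x (ha.trans hx)).hasDerivWithinAt
  · intro x hx; rw [interior_Ici] at hx; exact hk x (le_of_lt hx)

lemma SC_step {f f' : ℝ → ℝ} (hd : ∀ x, HasDerivAt f (f' x) x) (h0 : f 0 = 0) (hk : SC f') :
    SC f := by
  intro x y hx hxy hfx
  obtain ⟨ξ, hξ, he⟩ := exists_hasDerivAt_eq_slope f f' hx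
    (fun z _ => (hd z).continuousAt.continuousWithinAt) (fun z _ => hd z)
  have h1 : 0 ≤ f' ξ := by
    rw [he, h0]; apply div_nonneg <;> linarith
  have := mono_from (fun x _ => hd x) hξ.1 (fun z hz => hk ξ z hξ.1 hz h1)
  exact hfx.trans (this (le_of_lt hξ.2) (hξ.2.le.trans hxy) hxy)

lemma SC1 : SC (fun w => 3 * w - 4 * sE w) := by
  refine SC_step (f' := fun w => 3 - 4 * sphi w) (fun x => ?_) (by simp [sE_zero]) ?_
  · refine (((hasDerivAt_id x).const_mul 3).sub ((sE_hasDeriv x).const_mul 4)).congr_deriv ?_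
    simp
  · intro x y hx hxy h
    have : sphi y ≤ sphi x := by
      unfold sphi; apply Real.exp_le_exp.2; nlinarith
    simp only at h ⊢; linarith

noncomputable def sN (w : ℝ) : ℝ := w^3 - 2*w^2*sE w - 2 * w * sphi w + 2 * sE w

lemma SC2 : SC sN := by
  refine SC_step (f' := fun w => w * (3 * w - 4 * sE w)) (fun x => ?_) (by simp [sN, sE_zero]) ?_
  · have := ((((hasDerivAt_pow 3 x)).sub ((((hasDerivAt_pow 2 x).const_mul 2)).mul (sE_hasDeriv x))).sub
      (((hasDerivAt_id x).const_mul 2).mul (sphi_hasDeriv x))).add ((sE_hasDeriv x).const_mul 2)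
    refine (this.congr_deriv ?_)
    simp; ring
  · intro x y hx hxy h
    have h1 := SC1 x y hx hxy (nonneg_of_mul_nonneg_right h hx)
    exact mul_nonneg (by linarith) h1

noncomputable def sH (w : ℝ) : ℝ := Real.pi - sphi w - 2 * (sphi w * sE w / w) - 2 * sE w ^ 2

lemma sH_hasDeriv (w : ℝ) (hw : 0 < w) : HasDerivAt sH (sphi w / w^2 * sN w) w := by
  have := (((sphi_hasDeriv w).const_sub Real.pi).sub
    ((((sphi_hasDeriv w).mul (sE_hasDeriv w)).div (hasDerivAt_id w) hw.ne').const_mul 2)).sub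
    (((sE_hasDeriv w).pow 2).const_mul 2)
  refine (this.congr_deriv ?_)
  unfold sN
  simp; field_simp; ring

lemma SC3 (x y : ℝ) (hx : 0 < x) (hxy : x ≤ y) (h : sH x ≤ 0) : sH y ≤ 0 := by
  by_contra! hy
  have hlt : x < y := lt_of_le_of_ne hxy (by rintro rfl; linarith)
  obtain ⟨ξ, hξ, he⟩ := exists_hasDerivAt_eq_slope sH (fun w => sphi w / w^2 * sN w) hlt
    (fun z hz => (sH_hasDeriv z (hx.trans_le hz.1)).continuousAt.continuousWithinAt)
    (fun z hz => sH_hasDeriv z (hx.trans hz.1))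
  have hξ0 : 0 < ξ := hx.trans hξ.1
  have h1 : 0 ≤ sphi ξ / ξ^2 * sN ξ := by
    rw [he]; apply div_nonneg <;> linarith
  have h2 : 0 ≤ sN ξ := nonneg_of_mul_nonneg_right h1 (by have := sphi_pos ξ; positivity)
  have hm := mono_from sH_hasDeriv hξ0 (fun z hz => mul_nonneg (by have := sphi_pos z; positivity)
    (SC2 ξ z hξ0 hz h2))
  have hl : Tendsto (fun z => Real.pi - 2 * sE z ^ 2) atTop (𝓝 0) := by
    have := ((sE_tendsto.pow 2).const_mul 2).const_sub Real.pi
    rw [sc_sq] at this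
    convert this using 2; ring
  have := ge_of_tendsto hl (b := sH y) (by
    filter_upwards [eventually_ge_atTop y] with z hz
    have h4 : sH y ≤ sH z := hm hξ.2.le (hξ.2.le.trans hz) hz
    have h5 : 0 ≤ sphi z * sE z / z := by
      have := sphi_pos z
      have hz0 : 0 ≤ z := by linarith
      have := sE_nonneg hz0
      positivity
    have := sphi_pos z
    unfold sH at h4 ⊢; linarith)
  linarith

noncomputable def sG (w : ℝ) : ℝ := sphi w + Real.pi * w^2 / 2 - (sphi w + w * sE w)^2

lemma sG_hasDeriv (w : ℝ) (hw : 0 < w) : HasDerivAt sG (w * sH w) w := by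
  have := ((sphi_hasDeriv w).add (((hasDerivAt_pow 2 w).const_mul Real.pi).div_const 2)).sub
    (((sphi_hasDeriv w).add ((hasDerivAt_id w).mul (sE_hasDeriv w))).pow 2)
  refine (this.congr_deriv ?_)
  unfold sH
  simp; field_simp; ring

lemma sG_cont : Continuous sG := by
  have h1 := sphi_cont
  have h2 : Continuous sE := continuous_iff_continuousAt.2 fun x => (sE_hasDeriv x).continuousAt
  unfold sG; fun_prop

lemma sG_nonneg_pos {x : ℝ} (hx : 0 < x) : 0 ≤ sG x := by
  by_contra! hG
  have h0 : sG 0 = 0 := by simp [sG, sphi_zero]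
  obtain ⟨ξ, hξ, he⟩ := exists_hasDerivAt_eq_slope sG (fun w => w * sH w) hx
    sG_cont.continuousOn (fun z hz => sG_hasDeriv z hz.1)
  have h1 : ξ * sH ξ ≤ 0 := by
    rw [he, h0]; apply div_nonpos_of_nonpos_of_nonneg <;> linarith
  have h2 : sH ξ ≤ 0 := by
    by_contra! h; nlinarith [mul_pos hξ.1 h]
  have hm := mono_from (f := fun w => - sG w) (fun z hz => (sG_hasDeriv z hz).neg) hξ.1 (fun z hz => by
    have := SC3 ξ z hξ.1 hz h2
    have : 0 < z := hξ.1.trans_le hz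
    nlinarith)
  have hl : Tendsto (fun z => -(sphi z ^ 2 + 2 * sc * (z * sphi z))) atTop (𝓝 0) := by
    have := ((sphi_tendsto.pow 2).add (wsphi_tendsto.const_mul (2*sc))).neg
    simpa using this
  have := le_of_tendsto hl (b := sG x) (by
    filter_upwards [eventually_ge_atTop x] with z hz
    have h4 : - sG x ≤ - sG z := hm hξ.2.le (hξ.2.le.trans hz) hz
    have hz0 : 0 < z := by linarith
    have h5 := sphi_pos z
    have h6 := sE_nonneg hz0.le
    have h7 := sE_le z
    have h8 := sc_sq
    have h9 : z * sphi z * sE z ≤ z * sphi z * sc := mul_le_mul_of_nonneg_left h7 (by positivity)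
    have h10 : z^2 * sE z ^2 ≤ z^2 * sc^2 := by gcongr
    rw [h8] at h10
    unfold sG at h4 ⊢; nlinarith)
  linarith

lemma sG_nonneg (x : ℝ) : 0 ≤ sG x := by
  rcases lt_trichotomy x 0 with h | h | h
  · have := sG_nonneg_pos (x := -x) (by linarith)
    simpa [sG, sphi_neg, sE_neg] using this
  · subst h; simp [sG, sphi_zero]
  · exact sG_nonneg_pos h

lemma key_ineq (w : ℝ) : (sphi w - w * sU w) * (sphi w + w * sP w) ≤ sphi w := by
  have h := sG_nonneg w
  have h2 := sc_sq
  rw [sU_eq, sP_eq]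
  unfold sG at h
  have : Real.pi = 2 * sc^2 := by linarith
  rw [this] at h
  nlinarith

lemma hphi_int {h : ℝ → ℝ} (hm : Measurable h) {M : ℝ} (hb : ∀ x, |h x| ≤ M) :
    Integrable (fun x => h x * sphi x) :=
  sphi_int.bdd_mul hm.aestronglyMeasurable (Eventually.of_forall fun x => by
    rw [Real.norm_eq_abs]; exact hb x)

lemma steinNh_eq (h : ℝ → ℝ) : 2 * sc * steinNh h = ∫ x, h x * sphi x := by
  unfold steinNh
  rw [integral_gaussianReal_eq_integral_smul (by norm_num)]
  rw [← integral_const_mul]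
  congr 1
  funext x
  have h2 := sc_pos
  simp only [gaussianPDFReal, sphi, smul_eq_mul, NNReal.coe_one, mul_one, sub_zero]
  rw [← two_sc]
  field_simp

lemma centered {h : ℝ → ℝ} (hm : Measurable h) {M : ℝ} (hb : ∀ x, |h x| ≤ M) :
    Integrable (fun x => (h x - steinNh h) * sphi x) ∧ ∫ x, (h x - steinNh h) * sphi x = 0 := by
  have e : (fun x => (h x - steinNh h) * sphi x) = fun x => h x * sphi x - steinNh h * sphi x := by
    funext x; ring
  have h1 := hphi_int hm hb
  have h2 := sphi_int.const_mul (steinNh h)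
  rw [e]
  refine ⟨h1.sub h2, ?_⟩
  rw [integral_sub h1 h2, integral_const_mul, sphi_total, ← steinNh_eq]; ring

noncomputable def sF (k : ℝ → ℝ) (N : ℝ) (w : ℝ) : ℝ := ∫ x in Iic w, (k x - N) * sphi x

lemma sF_Ioi {k : ℝ → ℝ} {N : ℝ} (hi : Integrable (fun x => (k x - N) * sphi x))
    (h0 : ∫ x, (k x - N) * sphi x = 0) (w : ℝ) : sF k N w = -∫ x in Ioi w, (k x - N) * sphi x := by
  have := split_int hi w
  unfold sF; linarith

lemma sF_abs {k : ℝ → ℝ} {N C : ℝ} (hC : ∀ x, |k x - N| ≤ C) (w : ℝ) : |sF k N w| ≤ C * sP w := by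
  unfold sF sP
  rw [← integral_const_mul, ← Real.norm_eq_abs]
  refine norm_integral_le_of_norm_le (sphi_int.const_mul C).integrableOn (Eventually.of_forall fun x => ?_)
  rw [norm_mul, Real.norm_eq_abs, Real.norm_of_nonneg (sphi_pos x).le]
  exact mul_le_mul_of_nonneg_right (hC x) (sphi_pos x).le

lemma sF_abs' {k : ℝ → ℝ} {N C : ℝ} (hi : Integrable (fun x => (k x - N) * sphi x))
    (h0 : ∫ x, (k x - N) * sphi x = 0) (hC : ∀ x, |k x - N| ≤ C) (w : ℝ) :
    |sF k N w| ≤ C * sU w := by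
  rw [sF_Ioi hi h0, abs_neg]
  unfold sU
  rw [← integral_const_mul, ← Real.norm_eq_abs]
  refine norm_integral_le_of_norm_le (sphi_int.const_mul C).integrableOn (Eventually.of_forall fun x => ?_)
  rw [norm_mul, Real.norm_eq_abs, Real.norm_of_nonneg (sphi_pos x).le]
  exact mul_le_mul_of_nonneg_right (hC x) (sphi_pos x).le

lemma sF_mono {k : ℝ → ℝ} {N : ℝ} (hk : Monotone k) (hi : Integrable (fun x => (k x - N) * sphi x))
    (h0 : ∫ x, (k x - N) * sphi x = 0) (w : ℝ) :
    sF k N w ≤ (k w - N) * sP w ∧ sF k N w ≤ - ((k w - N) * sU w) := by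
  constructor
  · unfold sF sP
    rw [← integral_const_mul]
    refine setIntegral_mono_on hi.integrableOn (sphi_int.const_mul _).integrableOn measurableSet_Iic ?_
    intro x hx
    have := hk hx
    exact mul_le_mul_of_nonneg_right (by linarith) (sphi_pos x).le
  · rw [sF_Ioi hi h0]
    apply neg_le_neg
    unfold sU
    rw [← integral_const_mul]
    refine setIntegral_mono_on (sphi_int.const_mul _).integrableOn hi.integrableOn measurableSet_Ioi ?_
    intro x hx
    have := hk (le_of_lt hx)
    exact mul_le_mul_of_nonneg_right (by linarith) (sphi_pos x).le

lemma sF_mono_bounds {k : ℝ → ℝ} {N : ℝ} (hk : Monotone k)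
    (hi : Integrable (fun x => (k x - N) * sphi x))
    (h0 : ∫ x, (k x - N) * sphi x = 0) (w : ℝ) :
    sF k N w ≤ 0 ∧ (1 + w^2) * sF k N w + w * (k w - N) * sphi w ≤ 0 := by
  obtain ⟨h1, h2⟩ := sF_mono hk hi h0 w
  have hP := sP_nonneg w
  have hU := sU_nonneg w
  have hp := sphi_pos w
  have hF : sF k N w ≤ 0 := by
    rcases le_total 0 (k w - N) with h | h
    · nlinarith [mul_nonneg h hU]
    · nlinarith [mul_nonneg (neg_nonneg.2 h) hP]
  refine ⟨hF, ?_⟩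
  have hw : 0 < 1 + w^2 := by positivity
  rcases le_total 0 (k w - N) with h | h
  · have a1 := mul_le_mul_of_nonneg_left h2 hw.le
    have a2 := mul_le_mul_of_nonneg_left (M2 w) h
    nlinarith
  · have a1 := mul_le_mul_of_nonneg_left h1 hw.le
    have a2 := mul_le_mul_of_nonneg_left (M2' w) (neg_nonneg.2 h)
    nlinarith

/-- one-sided bounds for Lipschitz functions, by comparison with the identity -/
lemma lip_bounds {h : ℝ → ℝ} {N C : ℝ} (hl : ∀ x y, |h x - h y| ≤ C * |x - y|)
    (hi : Integrable (fun x => (h x - N) * sphi x))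
    (h0 : ∫ x, (h x - N) * sphi x = 0) (w : ℝ) :
    sF h N w ≤ C * sphi w ∧ (1 + w^2) * sF h N w + w * (h w - N) * sphi w ≤ C * sphi w := by
  have hk : Monotone (fun x => C * x + h x) := by
    intro x y hxy
    have := hl x y
    rw [abs_sub_comm x y, abs_of_nonneg (sub_nonneg.2 hxy)] at this
    have := (abs_le.1 this).2
    simp only; linarith
  have e : (fun x => (C * x + h x - N) * sphi x) = fun x => C * (x * sphi x) + (h x - N) * sphi x := by
    funext x; ring
  have hi' : Integrable (fun x => (C * x + h x - N) * sphi x) := by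
    rw [e]; exact (xsphi_int.const_mul C).add hi
  have h0' : ∫ x, (C * x + h x - N) * sphi x = 0 := by
    rw [e, integral_add (xsphi_int.const_mul C) hi, h0, integral_const_mul, xsphi_total]; simp
  have hF : sF (fun x => C * x + h x) N w = - C * sphi w + sF h N w := by
    unfold sF
    simp only
    rw [e, integral_add (xsphi_int.const_mul C).integrableOn hi.integrableOn, integral_const_mul, xsphi_Iic]
    ring
  obtain ⟨h1, h2⟩ := sF_mono_bounds hk hi' h0' w
  rw [hF] at h1 h2
  constructor
  · linarith
  · nlinarith

lemma sF_neg (h : ℝ → ℝ) (N w : ℝ) : sF (fun x => - h x) (-N) w = - sF h N w := by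
  unfold sF
  rw [← integral_neg]
  congr 1; funext x; ring

lemma lip_bounds_abs {h : ℝ → ℝ} {N C : ℝ} (hl : ∀ x y, |h x - h y| ≤ C * |x - y|)
    (hi : Integrable (fun x => (h x - N) * sphi x))
    (h0 : ∫ x, (h x - N) * sphi x = 0) (w : ℝ) :
    |sF h N w| ≤ C * sphi w ∧ |(1 + w^2) * sF h N w + w * (h w - N) * sphi w| ≤ C * sphi w := by
  obtain ⟨a1, a2⟩ := lip_bounds hl hi h0 w
  have e : (fun x => (- h x - -N) * sphi x) = fun x => -((h x - N) * sphi x) := by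
    funext x; ring
  obtain ⟨b1, b2⟩ := lip_bounds (h := fun x => - h x) (N := -N) (C := C)
    (fun x y => by rw [abs_sub_comm x y]; convert hl y x using 2 <;> ring_nf)
    (by rw [e]; exact hi.neg) (by rw [e, integral_neg, h0, neg_zero]) w
  rw [sF_neg] at b1 b2
  refine ⟨abs_le.2 ⟨by linarith, a1⟩, abs_le.2 ⟨by nlinarith, a2⟩⟩

/-- the derivative bound -/
lemma deriv_bound {h : ℝ → ℝ} {N C : ℝ} (hl : ∀ x y, |h x - h y| ≤ C * |x - y|)
    (hi : Integrable (fun x => (h x - N) * sphi x))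
    (h0 : ∫ x, (h x - N) * sphi x = 0) (w : ℝ) :
    sc * |w * sF h N w + (h w - N) * sphi w| ≤ C * sphi w := by
  have hp := sphi_pos w
  have e : (fun x => (h x - h w) * sphi x) = fun x => (h x - N) * sphi x - (h w - N) * sphi x := by
    funext x; ring
  have hj : Integrable (fun x => (h x - h w) * sphi x) := by
    rw [e]; exact hi.sub (sphi_int.const_mul _)
  have hx1 : Integrable (fun x => C * (w * sphi x - x * sphi x)) :=
    (((sphi_int.const_mul w).sub xsphi_int).const_mul C)
  have hx2 : Integrable (fun x => C * (x * sphi x - w * sphi x)) :=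
    ((xsphi_int.sub (sphi_int.const_mul w)).const_mul C)
  set A := ∫ x in Iic w, (h x - h w) * sphi x with hA
  set B := ∫ x in Ioi w, (h x - h w) * sphi x with hB
  have hAF : A = sF h N w - (h w - N) * sP w := by
    rw [hA, e, integral_sub hi.integrableOn (sphi_int.const_mul _).integrableOn, integral_const_mul]; rfl
  have hBF : B = - sF h N w - (h w - N) * sU w := by
    rw [hB, e, integral_sub hi.integrableOn (sphi_int.const_mul _).integrableOn, integral_const_mul,
      sF_Ioi hi h0, neg_neg]; rfl
  have bA : |A| ≤ C * (sphi w + w * sP w) := by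
    have : C * (sphi w + w * sP w) = ∫ x in Iic w, C * (w * sphi x - x * sphi x) := by
      rw [integral_const_mul, integral_sub (sphi_int.const_mul w).integrableOn xsphi_int.integrableOn,
        xsphi_Iic, integral_const_mul]
      unfold sP; ring
    rw [this, hA, ← Real.norm_eq_abs]
    refine norm_integral_le_of_norm_le hx1.integrableOn ?_
    filter_upwards [ae_restrict_mem measurableSet_Iic] with x hx
    rw [norm_mul, Real.norm_eq_abs, Real.norm_of_nonneg (sphi_pos x).le]
    have := hl x w
    rw [abs_sub_comm x w, abs_of_nonneg (a := w - x) (sub_nonneg.2 hx)] at this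
    nlinarith [sphi_pos x]
  have bB : |B| ≤ C * (sphi w - w * sU w) := by
    have : C * (sphi w - w * sU w) = ∫ x in Ioi w, C * (x * sphi x - w * sphi x) := by
      rw [integral_const_mul, integral_sub xsphi_int.integrableOn (sphi_int.const_mul w).integrableOn,
        xsphi_Ioi, integral_const_mul]
      unfold sU; ring
    rw [this, hB, ← Real.norm_eq_abs]
    refine norm_integral_le_of_norm_le hx2.integrableOn ?_
    filter_upwards [ae_restrict_mem measurableSet_Ioi] with x hx
    rw [norm_mul, Real.norm_eq_abs, Real.norm_of_nonneg (sphi_pos x).le]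
    have := hl x w
    rw [abs_of_nonneg (a := x - w) (sub_nonneg.2 (le_of_lt hx))] at this
    nlinarith [sphi_pos x]
  have q1 : 0 ≤ sphi w - w * sU w := by linarith [M1 w]
  have q2 : 0 ≤ sphi w + w * sP w := by linarith [M1' w]
  have hC : 0 ≤ C := by
    have := hl 1 0
    simp at this
    exact (abs_nonneg _).trans this
  have id1 : 2 * sc * (w * sF h N w + (h w - N) * sphi w) =
      -((sphi w - w * sU w) * A + (sphi w + w * sP w) * B) := by
    rw [hAF, hBF, ← sPU w]; ring
  have : |2 * sc * (w * sF h N w + (h w - N) * sphi w)| ≤ 2 * C * sphi w := by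
    rw [id1, abs_neg]
    refine (abs_add_le _ _).trans ?_
    rw [abs_mul, abs_mul, abs_of_nonneg q1, abs_of_nonneg q2]
    have r1 := mul_le_mul_of_nonneg_left bA q1
    have r2 := mul_le_mul_of_nonneg_left bB q2
    have r3 := mul_le_mul_of_nonneg_left (key_ineq w) hC
    nlinarith
  rw [abs_mul, abs_of_pos (by have := sc_pos; positivity)] at this
  linarith

lemma steinSol_eq (h : ℝ → ℝ) : steinSol h = fun w => sexp w * sF h (steinNh h) w := rfl

lemma part1_deriv {h : ℝ → ℝ} {N C : ℝ} (hi : Integrable (fun x => (h x - N) * sphi x))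
    (h0 : ∫ x, (h x - N) * sphi x = 0) (hC : ∀ x, |h x - N| ≤ C) (w : ℝ) :
    |deriv (fun w => sexp w * sF h N w) w| ≤ 2 * C := by
  have hC0 : 0 ≤ C := (abs_nonneg _).trans (hC 0)
  have he := sexp_pos w
  have hp := sphi_pos w
  have hep := sexp_mul w
  by_cases hd : DifferentiableAt ℝ (fun w => sexp w * sF h N w) w
  swap
  · rw [deriv_zero_of_not_differentiableAt hd]; simpa using hC0
  have hFd : DifferentiableAt ℝ (sF h N) w := by
    have e : sF h N = fun w => sphi w * (sexp w * sF h N w) := by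
      funext v
      have := sexp_mul v
      linear_combination (-sF h N v) * this
    rw [e]
    exact (sphi_hasDeriv w).differentiableAt.mul hd
  have hD := hFd.hasDerivAt
  have hder : deriv (fun w => sexp w * sF h N w) w =
      w * sexp w * sF h N w + sexp w * deriv (sF h N) w := ((sexp_hasDeriv w).mul hD).deriv
  rw [hder]
  have hPd := hasDeriv_Iic sphi_int w sphi_cont.continuousAt
  have mono1 : ∀ x y, x ≤ y → |sF h N y - sF h N x| ≤ C * (sP y - sP x) := by
    intro x y hxy
    unfold sF sP
    rw [intervalIntegral.integral_Iic_sub_Iic hi.integrableOn hi.integrableOn,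
      intervalIntegral.integral_Iic_sub_Iic sphi_int.integrableOn sphi_int.integrableOn,
      ← intervalIntegral.integral_const_mul, ← Real.norm_eq_abs]
    refine intervalIntegral.norm_integral_le_of_norm_le hxy (Eventually.of_forall fun z _ => ?_)
      (sphi_int.const_mul C).intervalIntegrable
    rw [norm_mul, Real.norm_eq_abs, Real.norm_of_nonneg (sphi_pos z).le]
    exact mul_le_mul_of_nonneg_right (hC z) (sphi_pos z).le
  have d1 : 0 ≤ C * sphi w - deriv (sF h N) w := by
    have hm : Monotone (fun w => C * sP w - sF h N w) := by
      intro x y hxy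
      have := (abs_le.1 (mono1 x y hxy)).2
      simp only; linarith
    have := (hm.monotoneOn univ).derivWithin_nonneg (x := w)
    have hde : deriv (fun w => C * sP w - sF h N w) w = C * sphi w - deriv (sF h N) w :=
      ((hPd.const_mul C).sub hD).deriv
    rw [derivWithin_univ, hde] at this
    exact this
  have d2 : 0 ≤ C * sphi w + deriv (sF h N) w := by
    have hm : Monotone (fun w => C * sP w + sF h N w) := by
      intro x y hxy
      have := (abs_le.1 (mono1 x y hxy)).1
      simp only; linarith
    have := (hm.monotoneOn univ).derivWithin_nonneg (x := w)
    have hde : deriv (fun w => C * sP w + sF h N w) w = C * sphi w + deriv (sF h N) w :=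
      ((hPd.const_mul C).add hD).deriv
    rw [derivWithin_univ, hde] at this
    exact this
  have dd : |sexp w * deriv (sF h N) w| ≤ C := by
    rw [abs_mul, abs_of_pos he]
    have : |deriv (sF h N) w| ≤ C * sphi w := abs_le.2 ⟨by linarith, by linarith⟩
    calc _ ≤ sexp w * (C * sphi w) := by gcongr
      _ = C := by linear_combination C * hep
  have dw : |w * sexp w * sF h N w| ≤ C := by
    have : |w| * |sF h N w| ≤ C * sphi w := by
      rcases le_total 0 w with hw | hw
      · rw [abs_of_nonneg hw]
        have := mul_le_mul_of_nonneg_left (sF_abs' hi h0 hC w) hw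
        nlinarith [M1 w]
      · rw [abs_of_nonpos hw]
        have := mul_le_mul_of_nonneg_left (sF_abs (N := N) hC w) (neg_nonneg.2 hw)
        nlinarith [M1' w]
    rw [abs_mul, abs_mul, abs_of_pos he]
    calc _ = sexp w * (|w| * |sF h N w|) := by ring
      _ ≤ sexp w * (C * sphi w) := by gcongr
      _ = C := by linear_combination C * hep
  refine (abs_add_le _ _).trans ?_
  linarith

lemma part1_sol {h : ℝ → ℝ} {N C : ℝ} (hi : Integrable (fun x => (h x - N) * sphi x))
    (h0 : ∫ x, (h x - N) * sphi x = 0) (hC : ∀ x, |h x - N| ≤ C) (w : ℝ) :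
    |sexp w * sF h N w| ≤ sc * C := by
  have hC0 : 0 ≤ C := (abs_nonneg _).trans (hC 0)
  have he := sexp_pos w
  rw [abs_mul, abs_of_pos he]
  rcases le_total 0 w with hw | hw
  · have := mul_le_mul_of_nonneg_left (sF_abs' hi h0 hC w) he.le
    nlinarith [mul_le_mul_of_nonneg_left (M3 hw) hC0]
  · have := mul_le_mul_of_nonneg_left (sF_abs (N := N) hC w) he.le
    nlinarith [mul_le_mul_of_nonneg_left (M3' hw) hC0]

theorem stmt11 (h : ℝ → ℝ) (hmeas : Measurable h) (M : ℝ) (hbdd : ∀ x, |h x| ≤ M) :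
    (∀ C : ℝ, (∀ x, |h x - steinNh h| ≤ C) →
      (∀ w, |steinSol h w| ≤ Real.sqrt (Real.pi / 2) * C) ∧
      (∀ w, |deriv (steinSol h) w| ≤ 2 * C)) ∧
    (∀ h' : ℝ → ℝ, (∀ x, HasDerivAt h (h' x) x) → ∀ C' : ℝ, (∀ x, |h' x| ≤ C') →
      (∀ w, |steinSol h w| ≤ 2 * C') ∧
      (∀ w, |deriv (steinSol h) w| ≤ Real.sqrt (2 / Real.pi) * C') ∧
      (∀ w, |deriv (deriv (steinSol h)) w| ≤ 2 * C')) := by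
  obtain ⟨hi, h0⟩ := centered hmeas hbdd
  rw [steinSol_eq]
  generalize steinNh h = N at hi h0
  constructor
  · intro C hC
    exact ⟨part1_sol hi h0 hC, part1_deriv hi h0 hC⟩
  · intro h' hd C hC
    have hC0 : 0 ≤ C := (abs_nonneg _).trans (hC 0)
    have hl : ∀ x y, |h x - h y| ≤ C * |x - y| := by
      intro x y
      have := (convex_univ (𝕜 := ℝ) (E := ℝ)).norm_image_sub_le_of_norm_hasDerivWithin_le
        (fun z _ => (hd z).hasDerivWithinAt) (fun z _ => hC z) (mem_univ y) (mem_univ x)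
      simpa using this
    have hF : ∀ w, HasDerivAt (sF h N) ((h w - N) * sphi w) w := fun w =>
      hasDeriv_Iic hi w (((hd w).continuousAt.sub continuousAt_const).mul sphi_cont.continuousAt)
    have hg : ∀ w, HasDerivAt (fun w => sexp w * sF h N w)
        (w * (sexp w * sF h N w) + (h w - N)) w := by
      intro w
      refine ((sexp_hasDeriv w).mul (hF w)).congr_deriv ?_
      linear_combination (h w - N) * sexp_mul w
    have hg' : deriv (fun w => sexp w * sF h N w) = fun w => w * (sexp w * sF h N w) + (h w - N) := by
      funext w; exact (hg w).deriv
    have hsol : ∀ w, |sexp w * sF h N w| ≤ C := by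
      intro w
      rw [abs_mul, abs_of_pos (sexp_pos w)]
      have := mul_le_mul_of_nonneg_left (lip_bounds_abs hl hi h0 w).1 (sexp_pos w).le
      nlinarith [sexp_mul w]
    refine ⟨fun w => (hsol w).trans (by linarith), fun w => ?_, fun w => ?_⟩
    · rw [hg']
      have h1 := deriv_bound hl hi h0 w
      have e : w * (sexp w * sF h N w) + (h w - N) = sexp w * (w * sF h N w + (h w - N) * sphi w) := by
        linear_combination (-(h w - N)) * sexp_mul w
      simp only
      rw [e, abs_mul, abs_of_pos (sexp_pos w)]
      have h2 : Real.sqrt (2 / Real.pi) = sc⁻¹ := by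
        unfold sc; rw [← Real.sqrt_inv, inv_div]
      rw [h2, inv_mul_eq_div, le_div_iff₀ sc_pos]
      have := mul_le_mul_of_nonneg_left h1 (sexp_pos w).le
      calc _ = sexp w * (sc * |w * sF h N w + (h w - N) * sphi w|) := by ring
        _ ≤ _ := this
        _ = C := by linear_combination C * sexp_mul w
    · rw [hg']
      have hgg := ((hasDerivAt_id w).mul (hg w)).add ((hd w).sub_const N)
      have e : deriv (fun w => w * (sexp w * sF h N w) + (h w - N)) w =
          sexp w * ((1 + w^2) * sF h N w + w * (h w - N) * sphi w) + h' w := by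
        refine Eq.trans hgg.deriv ?_
        simp only [id]
        linear_combination (-w * (h w - N)) * sexp_mul w
      rw [e]
      refine (abs_add_le _ _).trans ?_
      have h1 : |sexp w * ((1 + w^2) * sF h N w + w * (h w - N) * sphi w)| ≤ C := by
        rw [abs_mul, abs_of_pos (sexp_pos w)]
        have := mul_le_mul_of_nonneg_left (lip_bounds_abs hl hi h0 w).2 (sexp_pos w).le
        refine this.trans (le_of_eq ?_)
        linear_combination C * sexp_mul w
      linarith [hC w]
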